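/- Let a₀, …, a_n ∈ ℕ₀ and c₁, …, c_k ∈ ℤ, and assume that there exist pairwise distinct polynomials P₁(X), …, P_k(X) ∈ ℤ[X], each u-equivalent to Σ_{i=0}^n a_iX^i, such that c₁P₁(X) + … + c_kP_k(X) = 0 (as a polynomial). Then for every idempotent ultrafilter U on ℕ₀ and every A ∈ a₀U ⊕ a₁U ⊕ … ⊕ a_nU, there exist pairwise distinct elements x₁, …, x_k ∈ A such that c₁x₁ + … + c_kx_k = 0. -/

import Mathlib

open Ultrafilter Polynomial

/-- The pseudo-sum `U ⊕ V` of ultrafilters on `ℕ`: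
`A ∈ U ⊕ V ↔ {n | {m | n + m ∈ A} ∈ V} ∈ U`. -/
def pseudoSum (U V : Ultrafilter ℕ) : Ultrafilter ℕ :=
  U.bind fun n => V.map fun m => n + m

/-- The product `h U` of an ultrafilter on `ℕ` by a natural number:
`A ∈ h U ↔ {n | n * h ∈ A} ∈ U`. -/
def smulU (h : ℕ) (U : Ultrafilter ℕ) : Ultrafilter ℕ :=
  U.map fun n => n * h

/-- `U` is idempotent: non-principal and `U ⊕ U = U`. -/
def IsIdempotentUF (U : Ultrafilter ℕ) : Prop :=
  (∀ n : ℕ, U ≠ pure n) ∧ pseudoSum U U = U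

/-- The linear combination `d₀ U ⊕ d₁ U ⊕ … ⊕ dₙ U` associated to the string
`⟨d₀, …, dₙ⟩`; the empty string gives the principal ultrafilter at `0`. -/
def oplusU (U : Ultrafilter ℕ) : List ℕ → Ultrafilter ℕ
  | [] => pure 0
  | [d] => smulU d U
  | d :: l => pseudoSum (smulU d U) (oplusU U l)

/-- `u`-equivalence: the smallest equivalence relation on finite strings of
integers containing `ε ≈ᵤ ⟨0⟩`, `⟨a⟩ ≈ᵤ ⟨a,a⟩`, and coherent with concatenation. -/
inductive UEquiv : List ℤ → List ℤ → Prop where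
  | nil_zero : UEquiv [] [0]
  | dup (a : ℤ) : UEquiv [a] [a, a]
  | refl (l : List ℤ) : UEquiv l l
  | symm {l₁ l₂ : List ℤ} : UEquiv l₁ l₂ → UEquiv l₂ l₁
  | trans {l₁ l₂ l₃ : List ℤ} : UEquiv l₁ l₂ → UEquiv l₂ l₃ → UEquiv l₁ l₃
  | append {σ σ' τ τ' : List ℤ} : UEquiv σ σ' → UEquiv τ τ' →
      UEquiv (σ ++ τ) (σ' ++ τ')

/-- The string of coefficients of a polynomial, listed from degree 0 upward. -/
def coeffString (P : Polynomial ℤ) : List ℤ :=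
  (List.range (P.natDegree + 1)).map P.coeff

/-- Two polynomials are `u`-equivalent when their strings of coefficients are. -/
def PolyUEquiv (P Q : Polynomial ℤ) : Prop :=
  UEquiv (coeffString P) (coeffString Q)

theorem mem_pseudoSum {U V : Ultrafilter ℕ} {A : Set ℕ} :
    A ∈ pseudoSum U V ↔ {n | {m | n + m ∈ A} ∈ V} ∈ U :=
  Iff.rfl

theorem mem_smulU {h : ℕ} {U : Ultrafilter ℕ} {A : Set ℕ} :
    A ∈ smulU h U ↔ {n | n * h ∈ A} ∈ U :=
  Iff.rfl

theorem pseudoSum_pure_zero (U : Ultrafilter ℕ) : pseudoSum U (pure 0) = U := by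
  ext A
  simp [mem_pseudoSum]

theorem pure_zero_pseudoSum (U : Ultrafilter ℕ) : pseudoSum (pure 0) U = U := by
  ext A
  simp [mem_pseudoSum]

theorem pseudoSum_assoc (U V W : Ultrafilter ℕ) :
    pseudoSum (pseudoSum U V) W = pseudoSum U (pseudoSum V W) := by
  ext A
  simp [mem_pseudoSum, add_assoc]

theorem smulU_zero (U : Ultrafilter ℕ) : smulU 0 U = pure 0 := by
  refine Ultrafilter.coe_injective ?_
  simp [smulU, Filter.map_const]

theorem smulU_pseudoSum (h : ℕ) (U V : Ultrafilter ℕ) :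
    smulU h (pseudoSum U V) = pseudoSum (smulU h U) (smulU h V) := by
  ext A
  simp [mem_pseudoSum, mem_smulU, add_mul]

theorem oplusU_cons (U : Ultrafilter ℕ) (d : ℕ) (l : List ℕ) :
    oplusU U (d :: l) = pseudoSum (smulU d U) (oplusU U l) := by
  cases l with
  | nil => simp [oplusU, pseudoSum_pure_zero]
  | cons e l => rfl

theorem oplusU_append (U : Ultrafilter ℕ) (l₁ l₂ : List ℕ) :
    oplusU U (l₁ ++ l₂) = pseudoSum (oplusU U l₁) (oplusU U l₂) := by
  induction l₁ with
  | nil => simp [oplusU, pure_zero_pseudoSum]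
  | cons d l ih => simp [oplusU_cons, ih, pseudoSum_assoc]

theorem UEquiv.oplusU_eq {U : Ultrafilter ℕ} (hU : pseudoSum U U = U) {l₁ l₂ : List ℤ}
    (h : UEquiv l₁ l₂) : oplusU U (l₁.map Int.toNat) = oplusU U (l₂.map Int.toNat) := by
  induction h with
  | nil_zero => simp [oplusU, smulU_zero]
  | dup a => simp [oplusU, ← smulU_pseudoSum, hU]
  | refl l => rfl
  | symm _ ih => exact ih.symm
  | trans _ _ ih₁ ih₂ => exact ih₁.trans ih₂
  | append _ _ ih₁ ih₂ => simp [oplusU_append, ih₁, ih₂]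

theorem UEquiv.forall_nonneg_iff {l₁ l₂ : List ℤ} (h : UEquiv l₁ l₂) :
    (∀ x ∈ l₁, 0 ≤ x) ↔ ∀ x ∈ l₂, 0 ≤ x := by
  induction h with
  | nil_zero => simp
  | dup a => simp
  | refl l => rfl
  | symm _ ih => exact ih.symm
  | trans _ _ ih₁ ih₂ => exact ih₁.trans ih₂
  | append _ _ ih₁ ih₂ => simp only [List.forall_mem_append, ih₁, ih₂]

theorem uEquiv_coeffString_ofFn (P : Polynomial ℤ) {N : ℕ} (hN : P.natDegree < N) :
    UEquiv (coeffString P) (List.ofFn fun j : Fin N => P.coeff j) := by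
  have h : UEquiv (coeffString P) ((List.range N).map P.coeff) := by
    induction N, Nat.succ_le_of_lt hN using Nat.le_induction with
    | base => exact .refl _
    | succ N hN' ih =>
      have h0 : P.coeff N = 0 := Polynomial.coeff_eq_zero_of_natDegree_lt hN'
      have := (ih hN').append UEquiv.nil_zero
      simpa [List.range_succ, h0] using this
  rwa [List.ofFn_eq_map, ← List.map_coe_finRange_eq_range, List.map_map] at *

/-- The `N`-fold tensor power of an ultrafilter on `ℕ`. -/
def tensorPower (U : Ultrafilter ℕ) : (N : ℕ) → Ultrafilter (Fin N → ℕ)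
  | 0 => pure Fin.elim0
  | N + 1 => U.bind fun m => (tensorPower U N).map (Fin.cons m)

theorem eventually_tensorPower_succ {U : Ultrafilter ℕ} {N : ℕ} {p : (Fin (N + 1) → ℕ) → Prop} :
    (∀ᶠ u in (tensorPower U (N + 1) : Filter (Fin (N + 1) → ℕ)), p u) ↔
      ∀ᶠ m in (U : Filter ℕ), ∀ᶠ v in (tensorPower U N : Filter (Fin N → ℕ)),
        p (Fin.cons m v) :=
  Iff.rfl

theorem mem_oplusU_ofFn {U : Ultrafilter ℕ} {N : ℕ} (b : Fin N → ℕ) {A : Set ℕ} :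
    A ∈ oplusU U (List.ofFn b) ↔
      ∀ᶠ u in (tensorPower U N : Filter (Fin N → ℕ)), ∑ j, u j * b j ∈ A := by
  induction N generalizing A with
  | zero =>
    change _ ↔ {u : Fin 0 → ℕ | ∑ j, u j * b j ∈ A} ∈ (pure Fin.elim0 : Ultrafilter _)
    simp [oplusU]
  | succ N ih =>
    rw [List.ofFn_succ, oplusU_cons, eventually_tensorPower_succ]
    simp only [mem_pseudoSum, mem_smulU, ih, Fin.sum_univ_succ, Fin.cons_zero, Fin.cons_succ]
    rfl

theorem eventually_tensorPower_sum_ne {U : Ultrafilter ℕ} (hU : ∀ n, U ≠ pure n) {N : ℕ}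
    {d : Fin N → ℤ} (hd : d ≠ 0) (s : ℤ) :
    ∀ᶠ u in (tensorPower U N : Filter (Fin N → ℕ)), ∑ j, (u j : ℤ) * d j ≠ s := by
  induction N generalizing s with
  | zero => exact absurd (Subsingleton.elim _ _) hd
  | succ N ih =>
    rw [eventually_tensorPower_succ]
    simp only [Fin.sum_univ_succ, Fin.cons_zero, Fin.cons_succ]
    by_cases ht : Fin.tail d = 0
    · have hz : ∀ j : Fin N, d j.succ = 0 := congrFun ht
      have h0 : d 0 ≠ 0 := fun h0 => hd (funext (Fin.cases h0 hz))
      have hfin : {m : ℕ | (m : ℤ) * d 0 = s}.Subsingleton := fun m hm m' hm' => by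
        exact_mod_cast mul_right_cancel₀ h0 (hm.trans hm'.symm)
      have hmem : {m : ℕ | (m : ℤ) * d 0 = s} ∉ U := fun hmem => by
        obtain ⟨m, _, hm⟩ := Ultrafilter.eq_pure_of_finite_mem hfin.finite hmem
        exact hU m hm
      filter_upwards [Ultrafilter.compl_mem_iff_notMem.2 hmem] with m hm
      exact .of_forall fun v => by simpa [hz] using hm
    · filter_upwards with m
      filter_upwards [ih ht (s - m * d 0)] with v hv h
      exact hv (by simp only [Fin.tail]; linarith)

/-- Injective version: if the `Pᵢ` are pairwise distinct, the solutions
`x₁, …, x_k ∈ A` can be chosen pairwise distinct. -/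
theorem linear_pr_injective (n k : ℕ) (a : Fin (n + 1) → ℕ) (c : Fin k → ℤ)
    (P : Fin k → Polynomial ℤ) (hPdist : Function.Injective P)
    (hP : ∀ i, PolyUEquiv (P i)
      (∑ j : Fin (n + 1), Polynomial.C ((a j : ℤ)) * Polynomial.X ^ (j : ℕ)))
    (hlin : ∑ i, Polynomial.C (c i) * P i = 0)
    (U : Ultrafilter ℕ) (hU : IsIdempotentUF U)
    (A : Set ℕ) (hA : A ∈ oplusU U (List.ofFn a)) :
    ∃ x : Fin k → ℕ, Function.Injective x ∧ (∀ i, x i ∈ A) ∧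
      ∑ i, c i * (x i : ℤ) = 0 := by
  set Q : Polynomial ℤ := ∑ j : Fin (n + 1), Polynomial.C ((a j : ℤ)) * Polynomial.X ^ (j : ℕ)
    with hQ
  have hQcoeff : (fun j : Fin (n + 1) => Q.coeff j) = fun j => (a j : ℤ) := by
    funext j
    simp [hQ, Polynomial.finsetSum_coeff, Polynomial.coeff_X_pow, Fin.val_inj]
  have hQdeg : Q.natDegree < n + 1 :=
    Nat.lt_succ_of_le <| Polynomial.natDegree_sum_le_of_forall_le _ _ fun j _ =>
      (Polynomial.natDegree_C_mul_X_pow_le _ _).trans (Nat.le_of_lt_succ j.2)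
  obtain ⟨N, hN⟩ : ∃ N, ∀ i, (P i).natDegree < N :=
    ⟨(Finset.univ.sup fun i => (P i).natDegree) + 1, fun i =>
      Nat.lt_succ_of_le (Finset.le_sup (f := fun i => (P i).natDegree) (Finset.mem_univ i))⟩
  have hequiv (i : Fin k) : UEquiv (List.ofFn fun j : Fin N => (P i).coeff j)
      (List.ofFn fun j => (a j : ℤ)) :=
    (uEquiv_coeffString_ofFn _ (hN i)).symm.trans <|
      (hP i).trans (hQcoeff ▸ uEquiv_coeffString_ofFn Q hQdeg)
  have hnonneg (i : Fin k) (j : Fin N) : 0 ≤ (P i).coeff j :=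
    (hequiv i).forall_nonneg_iff.2 (by simp) _
      (List.mem_ofFn.2 ⟨j, rfl⟩)
  have hmem (i : Fin k) : ∀ᶠ u in (tensorPower U N : Filter (Fin N → ℕ)),
      ∑ j : Fin N, u j * ((P i).coeff j).toNat ∈ A := by
    rw [← mem_oplusU_ofFn (fun j => ((P i).coeff j).toNat)]
    have := (hequiv i).oplusU_eq hU.2
    simp only [List.map_ofFn, Function.comp_def, Int.toNat_natCast] at this
    rwa [this]
  have hne (p : Fin k × Fin k) : ∀ᶠ u in (tensorPower U N : Filter (Fin N → ℕ)),
      p.1 ≠ p.2 → ∑ j : Fin N, (u j : ℤ) * ((P p.1).coeff j - (P p.2).coeff j) ≠ 0 := by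
    by_cases hp : p.1 = p.2
    · simp [hp]
    have hd : (fun j : Fin N => (P p.1).coeff j - (P p.2).coeff j) ≠ 0 := fun hd =>
      hp <| hPdist <| Polynomial.ext fun m => by
        by_cases hm : m < N
        · exact sub_eq_zero.1 (congrFun hd ⟨m, hm⟩)
        · rw [Polynomial.coeff_eq_zero_of_natDegree_lt ((hN _).trans_le (not_lt.1 hm)),
            Polynomial.coeff_eq_zero_of_natDegree_lt ((hN _).trans_le (not_lt.1 hm))]
    exact (eventually_tensorPower_sum_ne hU.1 hd 0).mono fun _ h _ => h
  obtain ⟨u, hu, hu'⟩ := ((Filter.eventually_all.2 hmem).and (Filter.eventually_all.2 hne)).exists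
  have hcast (i : Fin k) : ((∑ j : Fin N, u j * ((P i).coeff j).toNat : ℕ) : ℤ) =
      ∑ j : Fin N, (u j : ℤ) * (P i).coeff j := by
    push_cast
    exact Finset.sum_congr rfl fun j _ => by rw [Int.toNat_of_nonneg (hnonneg i j)]
  refine ⟨fun i => ∑ j : Fin N, u j * ((P i).coeff j).toNat, fun i i' h => ?_, hu, ?_⟩
  · by_contra hii
    refine hu' (i, i') hii ?_
    simp only [mul_sub, Finset.sum_sub_distrib, ← hcast]
    exact sub_eq_zero.2 (congrArg Nat.cast h)
  · simp only [hcast, Finset.mul_sum]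
    rw [Finset.sum_comm]
    refine Finset.sum_eq_zero fun j _ => ?_
    have hj := congrArg (fun p => p.coeff (j : ℕ)) hlin
    simp only [Polynomial.finsetSum_coeff, Polynomial.coeff_C_mul, Polynomial.coeff_zero] at hj
    simp only [mul_left_comm _ (u j : ℤ), ← Finset.mul_sum, hj, mul_zero]
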